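/- Fix real numbers λ₁, λ₂, λ₃, λ₄ and let 𝔤 be the Lie algebra ℝ⁴ with the bracket determined by [e₁,e₃] = λ₂e₂ + λ₄e₄, [e₂,e₄] = λ₁e₁ + λ₃e₃, [e₂,e₃] = −λ₂e₁ − λ₃e₄, [e₃,e₄] = −λ₄e₁ + λ₃e₂, [e₄,e₁] = λ₁e₂ + λ₄e₃, [e₂,e₁] = −λ₂e₃ + λ₁e₄. With g the diagonal form of signature (2,2) (g(e₁,e₁)=g(e₂,e₂)=1, g(e₃,e₃)=g(e₄,e₄)=−1, g(eᵢ,eⱼ)=0 for i≠j), J the linear map with Je₁=e₃, Je₂=e₄, Je₃=−e₁, Je₄=−e₂, ∇ₓy := (1/2)[x,y], and F(x,y,z) := g(∇ₓ(Jy) − J(∇ₓy), z), the cyclic sum F(x,y,z) + F(y,z,x) + F(z,x,y) vanishes for all x, y, z ∈ 𝔤 (i.e. the corresponding almost complex manifold with Norden metric is quasi-Kähler, of class 𝒲₃). -/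

import Mathlib

noncomputable section

/-- The underlying vector space `ℝ⁴`. -/
abbrev V : Type := Fin 4 → ℝ

/-- The standard basis `e₁, e₂, e₃, e₄` of `ℝ⁴` (indexed by `0,…,3`). -/
def e : Fin 4 → V := fun i => Pi.single i 1

/-- The diagonal symmetric bilinear form of signature `(2,2)`:
`g(e₁,e₁)=g(e₂,e₂)=1`, `g(e₃,e₃)=g(e₄,e₄)=−1`, `g(eᵢ,eⱼ)=0` for `i ≠ j`. -/
def gf : V → V → ℝ := fun x y => x 0 * y 0 + x 1 * y 1 - x 2 * y 2 - x 3 * y 3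

/-- `εᵢ = g(eᵢ,eᵢ)`, the diagonal entries of the (inverse) metric. -/
def eps : Fin 4 → ℝ := ![1, 1, -1, -1]

theorem V.eq_sum_e (x : V) : x = x 0 • e 0 + x 1 • e 1 + x 2 • e 2 + x 3 • e 3 := by
  ext i
  fin_cases i <;> simp [e]

theorem gf_comm (x y : V) : gf x y = gf y x := by
  simp only [gf]
  ring

theorem gf_sub_left (x y z : V) : gf (x - y) z = gf x z - gf y z := by
  simp only [gf, Pi.sub_apply]
  ring

theorem gf_smul_left (c : ℝ) (x z : V) : gf (c • x) z = c * gf x z := by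
  simp only [gf, Pi.smul_apply, smul_eq_mul]
  ring

/-- The almost complex structure is self-adjoint with respect to the Norden metric. -/
theorem gf_map_left (J : V →ₗ[ℝ] V)
    (hJ1 : J (e 0) = e 2) (hJ2 : J (e 1) = e 3)
    (hJ3 : J (e 2) = -e 0) (hJ4 : J (e 3) = -e 1) (x y : V) :
    gf (J x) y = gf x (J y) := by
  have hJ (v : V) : J v = v 0 • e 2 + v 1 • e 3 - v 2 • e 0 - v 3 • e 1 := by
    conv_lhs => rw [V.eq_sum_e v]
    simp only [map_add, map_smul, hJ1, hJ2, hJ3, hJ4, smul_neg]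
    abel
  rw [hJ x, hJ y]
  simp [gf, e]
  ring

/-- The metric is invariant under the bracket: `g([x,y],z) = g(x,[y,z])`. -/
theorem gf_bracket_left (l1 l2 l3 l4 : ℝ)
    (B : V →ₗ[ℝ] V →ₗ[ℝ] V)
    (hanti : ∀ x y : V, B x y = -B y x)
    (h13 : B (e 0) (e 2) = l2 • e 1 + l4 • e 3)
    (h24 : B (e 1) (e 3) = l1 • e 0 + l3 • e 2)
    (h23 : B (e 1) (e 2) = -(l2 • e 0) - l3 • e 3)
    (h34 : B (e 2) (e 3) = -(l4 • e 0) + l3 • e 1)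
    (h41 : B (e 3) (e 0) = l1 • e 1 + l4 • e 2)
    (h21 : B (e 1) (e 0) = -(l2 • e 2) + l1 • e 3) (x y z : V) :
    gf (B x y) z = gf x (B y z) := by
  have hself (v : V) : B v v = 0 := self_eq_neg.mp (hanti v v)
  have hB (v w : V) : B v w =
      (v 0 * w 2 - v 2 * w 0) • (l2 • e 1 + l4 • e 3)
      + (v 1 * w 3 - v 3 * w 1) • (l1 • e 0 + l3 • e 2)
      + (v 1 * w 2 - v 2 * w 1) • (-(l2 • e 0) - l3 • e 3)
      + (v 2 * w 3 - v 3 * w 2) • (-(l4 • e 0) + l3 • e 1)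
      + (v 3 * w 0 - v 0 * w 3) • (l1 • e 1 + l4 • e 2)
      + (v 1 * w 0 - v 0 * w 1) • (-(l2 • e 2) + l1 • e 3) := by
    conv_lhs => rw [V.eq_sum_e v, V.eq_sum_e w]
    simp only [map_add, map_smul, LinearMap.add_apply, LinearMap.smul_apply, hself,
      hanti (e 2) (e 0), hanti (e 3) (e 1), hanti (e 2) (e 1), hanti (e 3) (e 2),
      hanti (e 0) (e 3), hanti (e 0) (e 1), h13, h24, h23, h34, h41, h21]
    module
  rw [hB x y, hB y z]
  simp [gf, e]
  ring

/-- The cyclic sum of F(x,y,z) = g((1/2)[x,Jy] − (1/2)J[x,y], z) vanishes,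
i.e. the manifold (G,J,g) is quasi-Kähler with Norden metric (class 𝒲₃). -/
theorem quasi_Kaehler (l1 l2 l3 l4 : ℝ)
    (B : V →ₗ[ℝ] V →ₗ[ℝ] V)
    (hanti : ∀ x y : V, B x y = -B y x)
    (h13 : B (e 0) (e 2) = l2 • e 1 + l4 • e 3)
    (h24 : B (e 1) (e 3) = l1 • e 0 + l3 • e 2)
    (h23 : B (e 1) (e 2) = -(l2 • e 0) - l3 • e 3)
    (h34 : B (e 2) (e 3) = -(l4 • e 0) + l3 • e 1)
    (h41 : B (e 3) (e 0) = l1 • e 1 + l4 • e 2)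
    (h21 : B (e 1) (e 0) = -(l2 • e 2) + l1 • e 3)
    (hJac : ∀ x y z : V, B (B x y) z + B (B y z) x + B (B z x) y = 0)
    (J : V →ₗ[ℝ] V)
    (hJ1 : J (e 0) = e 2) (hJ2 : J (e 1) = e 3)
    (hJ3 : J (e 2) = -e 0) (hJ4 : J (e 3) = -e 1)
    (F : V → V → V → ℝ)
    (hF : ∀ x y z : V,
      F x y z = gf ((1 / 2 : ℝ) • B x (J y) - (1 / 2 : ℝ) • J (B x y)) z)
    : ∀ x y z : V, F x y z + F y z x + F z x y = 0 := by
  intro x y z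
  have hinv := gf_bracket_left l1 l2 l3 l4 B hanti h13 h24 h23 h34 h41 h21
  have hrot (u v w : V) : gf (B u v) w = gf (B v w) u := by rw [hinv, gf_comm]
  have hF' (u v w : V) : F u v w = 1 / 2 * (gf (B u (J v)) w - gf (B u v) (J w)) := by
    rw [hF, gf_sub_left, gf_smul_left, gf_smul_left, gf_map_left J hJ1 hJ2 hJ3 hJ4]
    ring
  rw [hF', hF', hF', hrot x y (J z), hrot y z (J x), hrot z x (J y)]
  ring
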